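/- arXiv:2209.08805 — 2 statements merged into one kernel-verified Lean document; each statement's English description precedes it below -/
import Mathlib

section
/- Let M be a commutative monoid, r a positive integer, and let (φ_α)_{α ∈ ℕ^r} be a moment function sequence of rank r on M, and set m = φ_0. Then for every multi-index α in ℕ^r with |α| = N and for all y_1, y_2, …, y_{N+1} in M one has (Δ_{m;y_1} ∘ Δ_{m;y_2} ∘ ⋯ ∘ Δ_{m;y_{N+1}}) φ_α = 0; that is, every moment function of multi-degree α corresponding to m is a generalized m-exponential monomial of degree at most |α|. -/
/-- The modified difference `Δ_{m;y} f (x) = f(x·y) − m(y)·f(x)`. -/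
def mdiff {M : Type*} [CommMonoid M] (m : M → ℂ) (y : M) (f : M → ℂ) : M → ℂ :=
  fun x => f (x * y) - m y * f x

/-- A composition of modified differences commutes with finite linear combinations. -/
theorem foldr_mdiff_sum {M ι : Type*} [CommMonoid M] (m : M → ℂ) (l : List M)
    (s : Finset ι) (c : ι → ℂ) (f : ι → M → ℂ) :
    l.foldr (mdiff m) (∑ i ∈ s, c i • f i) = ∑ i ∈ s, c i • l.foldr (mdiff m) (f i) := by
  induction l with
  | nil => rfl
  | cons y l ih =>
    rw [List.foldr_cons, ih]
    funext x
    simp only [mdiff, List.foldr_cons, Finset.sum_apply, Pi.smul_apply, smul_eq_mul,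
      Finset.mul_sum, ← Finset.sum_sub_distrib]
    exact Finset.sum_congr rfl fun i _ => by ring

/-- The modified difference of a moment function is a linear combination of moment functions
of strictly smaller multi-degree. -/
theorem mdiff_moment {M : Type*} [CommMonoid M] {r : ℕ} (φ : (Fin r → ℕ) → M → ℂ)
    (hmom : ∀ (α : Fin r → ℕ) (x y : M),
      φ α (x * y) = ∑ β ∈ Finset.Iic α,
        (∏ i, ((α i).choose (β i) : ℂ)) * φ β x * φ (α - β) y)
    (α : Fin r → ℕ) (y : M) :
    mdiff (φ 0) y (φ α) =
      ∑ β ∈ Finset.Iio α, ((∏ i, ((α i).choose (β i) : ℂ)) * φ (α - β) y) • φ β := by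
  funext x
  simp only [mdiff, Finset.sum_apply, Pi.smul_apply, smul_eq_mul]
  rw [hmom, ← Finset.Iio_insert, Finset.sum_insert (by simp)]
  simp only [Nat.choose_self, Nat.cast_one, Finset.prod_const_one, one_mul, tsub_self]
  rw [mul_comm (φ α x), add_sub_cancel_left]
  exact Finset.sum_congr rfl fun β _ => by ring

/-- More than `|α|` modified differences annihilate the moment function of multi-degree `α`. -/
theorem foldr_mdiff_moment_eq_zero {M : Type*} [CommMonoid M] {r : ℕ}
    (φ : (Fin r → ℕ) → M → ℂ)
    (hmom : ∀ (α : Fin r → ℕ) (x y : M),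
      φ α (x * y) = ∑ β ∈ Finset.Iic α,
        (∏ i, ((α i).choose (β i) : ℂ)) * φ β x * φ (α - β) y)
    (l : List M) (α : Fin r → ℕ) (hα : ∑ i, α i < l.length) :
    l.foldr (mdiff (φ 0)) (φ α) = 0 := by
  induction l using List.reverseRecOn generalizing α with
  | nil => simp at hα
  | append_singleton l y ih =>
    rw [List.foldr_append, List.foldr_cons, List.foldr_nil, mdiff_moment φ hmom, foldr_mdiff_sum]
    refine Finset.sum_eq_zero fun β hβ => ?_
    have hlt : ∑ i, β i < ∑ i, α i := Fintype.sum_strictMono (Finset.mem_Iio.mp hβ)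
    rw [List.length_append, List.length_singleton] at hα
    rw [ih β (by omega), smul_zero]

/-- Every moment function of multi-degree `α` corresponding to `m = φ 0` is a
generalized `m`-exponential monomial of degree at most `|α|`. -/
theorem moment_is_generalized_exponential_monomial
    {M : Type*} [CommMonoid M] (r : ℕ) (hr : 0 < r)
    (φ : (Fin r → ℕ) → M → ℂ)
    (hmom : ∀ (α : Fin r → ℕ) (x y : M),
      φ α (x * y) = ∑ β ∈ Finset.Iic α,
        (∏ i, ((α i).choose (β i) : ℂ)) * φ β x * φ (α - β) y)
    (α : Fin r → ℕ) (N : ℕ) (hN : ∑ i, α i = N)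
    (ys : Fin (N + 1) → M) :
    (List.ofFn ys).foldr (mdiff (φ 0)) (φ α) = 0 := by
  exact foldr_mdiff_moment_eq_zero φ hmom (List.ofFn ys) α (by simp [hN])
end

section
/- Let M be a commutative monoid, r a positive integer, and let (φ_α)_{α ∈ ℕ^r} be a moment function sequence of rank r on M. Then for every α ∈ ℕ^r and every y ∈ M, the translate τ_y φ_α (defined by τ_y φ_α (x) = φ_α(x·y)) belongs to the ℂ-linear span of the finite family {φ_β : β ≤ α}; consequently, the variety of φ_α, i.e., the ℂ-linear span of all translates {τ_y φ_α : y ∈ M}, is a finite-dimensional ℂ-vector space. -/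
/-- For a moment function sequence `(φ_α)` of rank `r` on a commutative monoid, every
translate of `φ_α` lies in the span of the finite family `{φ_β : β ≤ α}`; hence the
variety of `φ_α` (the span of all of its translates) is finite dimensional. -/
theorem moment_function_variety_finiteDimensional
    {M : Type*} [CommMonoid M] (r : ℕ) (hr : 0 < r)
    (φ : (Fin r → ℕ) → M → ℂ)
    (hmom : ∀ (α : Fin r → ℕ) (x y : M),
      φ α (x * y) = ∑ β ∈ Finset.Iic α,
        (∏ i, ((α i).choose (β i) : ℂ)) * φ β x * φ (α - β) y)
    (α : Fin r → ℕ) :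
    (∀ y : M, (fun x => φ α (x * y)) ∈
        Submodule.span ℂ {f : M → ℂ | ∃ β ≤ α, f = φ β}) ∧
    FiniteDimensional ℂ
      (Submodule.span ℂ {f : M → ℂ | ∃ y : M, f = fun x => φ α (x * y)}) := by
  have translate_mem (y : M) : (fun x => φ α (x * y)) ∈
      Submodule.span ℂ {f : M → ℂ | ∃ β ≤ α, f = φ β} := by
    have translate_eq : (fun x => φ α (x * y)) = ∑ β ∈ Finset.Iic α,
        ((∏ i, ((α i).choose (β i) : ℂ)) * φ (α - β) y) • φ β := by
      funext x
      simp only [hmom α x y, Finset.sum_apply, Pi.smul_apply, smul_eq_mul]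
      exact Finset.sum_congr rfl fun β _ => by ring
    rw [translate_eq]
    exact Submodule.sum_mem _ fun β hβ => Submodule.smul_mem _ _
      (Submodule.subset_span ⟨β, Finset.mem_Iic.mp hβ, rfl⟩)
  refine ⟨translate_mem, ?_⟩
  have finite_family : {f : M → ℂ | ∃ β ≤ α, f = φ β}.Finite := by
    refine ((Set.finite_Iic α).image φ).subset ?_
    rintro _ ⟨β, hβ, rfl⟩
    exact ⟨β, hβ, rfl⟩
  have := FiniteDimensional.span_of_finite ℂ finite_family
  refine Submodule.finiteDimensional_of_le
    (S₂ := Submodule.span ℂ {f : M → ℂ | ∃ β ≤ α, f = φ β}) (Submodule.span_le.mpr ?_)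
  rintro _ ⟨y, rfl⟩
  exact translate_mem y
end
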